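/- Let β > 0, r ∈ ℕ, T > 0 and M ∈ ℕ with Mβ > d. There is a constant C, depending only on d and r, such that for every R ∈ Ψ_0^β and every j ∈ ℕ: ‖R^{*(M+j)}‖_{(M+j)β,0;T,r} ≤ C^j · ‖R^{*M}‖_{Mβ,0;T,r} · ‖R‖_{β,0;T,r+d+1}^j · Π_{i=1}^{j} B(((M+i−1)β − d)/2, β/2), with the convention that the product equals 1 when j = 0, where B(a,b) = ∫_0^1 (1−s)^{a−1} s^{b−1} ds is the Beta function (note R^{*M} ∈ Ψ_0^{Mβ} by stability of these spaces under convolution). -/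

import Mathlib

open MeasureTheory Filter
open scoped BigOperators ENNReal

namespace VarBPHZ

/-! ## Basic parabolic setting on `ℝ^{1+d}` -/

/-- A space-time point in `ℝ^{1+d}`; coordinate `0` is time, coordinates `1, …, d` are space. -/
abbrev Pt (d : ℕ) := Fin (d + 1) → ℝ

variable {d : ℕ}

/-- Parabolic scaled degree `|k|_𝔰 = 2k₀ + k₁ + ⋯ + k_d` of a multi-index. -/
def pdeg (k : Fin (d + 1) → ℕ) : ℕ := k 0 + ∑ i, k i

/-- Parabolic norm `|z|_𝔰 = |t|^{1/2} + ∑ᵢ |xᵢ|`. -/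
noncomputable def pnorm (z : Pt d) : ℝ := Real.sqrt |z 0| + ∑ i : Fin d, |z i.succ|

/-- First-order partial derivative in the `i`-th coordinate. -/
noncomputable def pd (i : Fin (d + 1)) (f : Pt d → ℝ) : Pt d → ℝ :=
  fun z => fderiv ℝ f z (Pi.single i 1)

/-- Iterated partial derivative `∂^k` for a multi-index `k`. -/
noncomputable def mderiv (k : Fin (d + 1) → ℕ) (f : Pt d → ℝ) : Pt d → ℝ :=
  (List.finRange (d + 1)).foldr (fun i g => (pd i)^[k i] g) f

/-- Mixed partial derivative `∂₁^j ∂₂^m` of a two-argument kernel. -/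
noncomputable def mderiv2 (j m : Fin (d + 1) → ℕ) (F : Pt d → Pt d → ℝ) :
    Pt d → Pt d → ℝ :=
  fun z zb => mderiv j (fun z' => mderiv m (F z') zb) z

/-- Space-time convolution `u * v (z, z̄) = ∫ u(z, ζ) v(ζ, z̄) dζ`. -/
noncomputable def conv (u v : Pt d → Pt d → ℝ) : Pt d → Pt d → ℝ :=
  fun z zb => ∫ ζ : Pt d, u z ζ * v ζ zb

/-! ## The heat calculus spaces `Ψ_r^α` and `Φ_r^α` -/

/-- `Ft` is an `F̃`-representation of `F` for the space `Ψ_r^α`; the second argument of `Ft`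
packs `(u, v) ∈ ℝ × ℝ^d` as an element of `ℝ^{1+d}`. -/
def PsiRep (α : ℝ) (Ft : Pt d → Pt d → ℝ) (F : Pt d → Pt d → ℝ) : Prop :=
  ∀ z zb : Pt d, F z zb =
    if zb 0 < z 0 then
      (z 0 - zb 0) ^ ((α - d - 2) / 2) *
        Ft zb (Fin.cons (Real.sqrt (z 0 - zb 0))
          fun i : Fin d => (z i.succ - zb i.succ) / Real.sqrt (z 0 - zb 0))
    else 0

/-- Existence (and continuity) of the derivatives of `F̃` entering the `Ψ_r^α` seminorms:
derivatives are counted parabolically in the first slot and by total order in the second. -/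
def PsiSmooth (r : ℕ) (Ft : Pt d → Pt d → ℝ) : Prop :=
  (∀ j m : Fin (d + 1) → ℕ, pdeg j + ∑ i, m i < r →
    Differentiable ℝ fun p : Pt d × Pt d => mderiv2 j m Ft p.1 p.2) ∧
  ∀ j m : Fin (d + 1) → ℕ, pdeg j + ∑ i, m i ≤ r →
    Continuous fun p : Pt d × Pt d => mderiv2 j m Ft p.1 p.2

/-- The set of numbers of which the `Ψ_r^α` seminorm `‖·‖_{α,r;T,n}` of a representation
`Ft` is the supremum. -/
def psiSet (r : ℕ) (T : ℝ) (n : ℕ) (Ft : Pt d → Pt d → ℝ) : Set ℝ :=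
  {y | ∃ (j m : Fin (d + 1) → ℕ) (w uv : Pt d),
    pdeg j + ∑ i, m i ≤ r ∧ 0 ≤ uv 0 ∧ uv 0 ≤ Real.sqrt T ∧
    y = (1 + Real.sqrt (∑ i : Fin d, uv i.succ ^ 2)) ^ n * |mderiv2 j m Ft w uv|}

/-- Membership in the heat-calculus space `Ψ_r^α`. -/
def MemPsi (α : ℝ) (r : ℕ) (F : Pt d → Pt d → ℝ) : Prop :=
  ∃ Ft, PsiRep α Ft F ∧ PsiSmooth r Ft ∧
    ∀ T : ℝ, 0 < T → ∀ n : ℕ, BddAbove (psiSet r T n Ft)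

/-- The `Ψ_r^α` seminorm `‖F‖_{α,r;T,n}` of a kernel `F`. -/
noncomputable def psiNorm (α : ℝ) (r : ℕ) (T : ℝ) (n : ℕ) (F : Pt d → Pt d → ℝ) : ℝ :=
  sInf {y | ∃ Ft, PsiRep α Ft F ∧ PsiSmooth r Ft ∧ BddAbove (psiSet r T n Ft) ∧
    y = sSup (psiSet r T n Ft)}

/-- Translation invariance of a two-argument kernel. -/
def TransInv (F : Pt d → Pt d → ℝ) : Prop := ∀ z zb h : Pt d, F (z + h) (zb + h) = F z zb

/-- Membership in `Φ_r^α`, the translation-invariant part of `Ψ_r^α`. -/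
def MemPhi (α : ℝ) (r : ℕ) (F : Pt d → Pt d → ℝ) : Prop := MemPsi α r F ∧ TransInv F

/-- `∂_w^m` of a family of kernels depending on a parameter `w`. -/
noncomputable def famDeriv (m : Fin (d + 1) → ℕ) (F : Pt d → Pt d → Pt d → ℝ) :
    Pt d → Pt d → Pt d → ℝ :=
  fun w z zb => mderiv m (fun w' => F w' z zb) w

/-- Membership in `C^m(Ψ_r^α)` for a family of kernels. -/
def MemCPsi (m : ℕ) (α : ℝ) (r : ℕ) (F : Pt d → Pt d → Pt d → ℝ) : Prop :=
  (∀ m' : Fin (d + 1) → ℕ, pdeg m' < m → ∀ z zb : Pt d,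
    Differentiable ℝ fun w => famDeriv m' F w z zb) ∧
  (∀ m' : Fin (d + 1) → ℕ, pdeg m' ≤ m → ∀ w : Pt d, MemPsi α r (famDeriv m' F w)) ∧
  ∀ T : ℝ, 0 < T → ∀ n : ℕ,
    BddAbove {y | ∃ (m' : Fin (d + 1) → ℕ) (w : Pt d), pdeg m' ≤ m ∧
      y = psiNorm α r T n (famDeriv m' F w)}

/-- The `C^m(Ψ_r^α)` seminorm `sup_w max_{|m'|_𝔰 ≤ m} ‖∂_w^{m'} F_w‖_{α,r;T,n}`. -/
noncomputable def cpsiNorm (m : ℕ) (α : ℝ) (r : ℕ) (T : ℝ) (n : ℕ)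
    (F : Pt d → Pt d → Pt d → ℝ) : ℝ :=
  sSup {y | ∃ (m' : Fin (d + 1) → ℕ) (w : Pt d), pdeg m' ≤ m ∧
    y = psiNorm α r T n (famDeriv m' F w)}

/-- Membership in `C^m(Φ_r^α)`. -/
def MemCPhi (m : ℕ) (α : ℝ) (r : ℕ) (F : Pt d → Pt d → Pt d → ℝ) : Prop :=
  MemCPsi m α r F ∧ ∀ w, TransInv (F w)

/-- The Beta function `B(a,b) = ∫₀¹ (1−s)^{a−1} s^{b−1} ds`. -/
noncomputable def betaFn (a b : ℝ) : ℝ := ∫ s in (0 : ℝ)..1, (1 - s) ^ (a - 1) * s ^ (b - 1)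

/-- Iterated self-convolution: `selfConv R m = R^{*(m+1)}`. -/
noncomputable def selfConv (R : Pt d → Pt d → ℝ) : ℕ → (Pt d → Pt d → ℝ)
  | 0 => R
  | k + 1 => conv (selfConv R k) R

/-! ## Auxiliary lemmas -/

/-- Euclidean length of the spatial part. -/
noncomputable def nv (v : Fin d → ℝ) : ℝ := Real.sqrt (∑ i, v i ^ 2)

lemma nv_eq (v : Fin d → ℝ) : nv v = ‖(WithLp.toLp 2 v : EuclideanSpace ℝ (Fin d))‖ := by
  simp [nv, EuclideanSpace.norm_eq]

lemma nv_nonneg (v : Fin d → ℝ) : 0 ≤ nv v := Real.sqrt_nonneg _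

lemma norm_le_nv (v : Fin d → ℝ) : ‖v‖ ≤ nv v := by
  refine (pi_norm_le_iff_of_nonneg (nv_nonneg v)).2 fun i => ?_
  rw [nv, Real.norm_eq_abs]
  refine Real.abs_le_sqrt ?_
  exact Finset.single_le_sum (f := fun i => v i ^ 2) (fun i _ => sq_nonneg _) (Finset.mem_univ i)

lemma nv_comb (a b : ℝ) (ha : |a| ≤ 1) (hb : |b| ≤ 1) (v q : Fin d → ℝ) :
    nv (a • v + b • q) ≤ nv v + nv q := by
  simp only [nv_eq, WithLp.toLp_add, WithLp.toLp_smul]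
  refine (norm_add_le _ _).trans ?_
  rw [norm_smul, norm_smul, Real.norm_eq_abs, Real.norm_eq_abs]
  exact add_le_add (mul_le_of_le_one_left (norm_nonneg _) ha)
    (mul_le_of_le_one_left (norm_nonneg _) hb)

lemma one_add_nv_le (a b : ℝ) (ha : |a| ≤ 1) (hb : |b| ≤ 1) (w v q : Fin d → ℝ)
    (h : w = a • v + b • q) : 1 + nv w ≤ (1 + nv v) * (1 + nv q) := by
  have := nv_comb a b ha hb v q
  rw [← h] at this
  nlinarith [nv_nonneg v, nv_nonneg q, mul_nonneg (nv_nonneg v) (nv_nonneg q)]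

lemma continuous_nv : Continuous (nv : (Fin d → ℝ) → ℝ) := by
  unfold nv; fun_prop

/-- Integrable decay profile. -/
noncomputable def prof (q : Fin d → ℝ) : ℝ := ((1 + ‖q‖) ^ (d + 1))⁻¹

lemma prof_nonneg (q : Fin d → ℝ) : 0 ≤ prof q := by unfold prof; positivity

lemma integrable_prof : Integrable (prof : (Fin d → ℝ) → ℝ) volume := by
  have := integrable_one_add_norm (E := Fin d → ℝ) (μ := volume) (r := ((d + 1 : ℕ) : ℝ))
    (by simp)
  refine this.congr (ae_of_all _ fun q => ?_)
  have h : (0 : ℝ) ≤ 1 + ‖q‖ := by positivity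
  simp only [prof]
  rw [Real.rpow_neg h, Real.rpow_natCast]

lemma prof_bound (q : Fin d → ℝ) : ((1 + nv q) ^ (d + 1))⁻¹ ≤ prof q := by
  unfold prof
  have := norm_le_nv q
  gcongr

lemma integral_prof_affine (a : Fin d → ℝ) (c : ℝ) (hc : 0 < c) :
    ∫ p : Fin d → ℝ, prof (a + c • p) = (c ^ d)⁻¹ * ∫ q : Fin d → ℝ, prof q := by
  rw [Measure.integral_comp_smul volume (fun q => prof (a + q)) c,
    integral_add_left_eq_self (fun q => prof q) a, Module.finrank_fin_fun, smul_eq_mul,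
    abs_of_pos (by positivity)]

lemma integrable_prof_affine (a : Fin d → ℝ) (c : ℝ) (hc : 0 < c) :
    Integrable (fun p : Fin d → ℝ => prof (a + c • p)) volume :=
  (integrable_prof.comp_add_left a).comp_smul hc.ne'

lemma beta_integrable {a b : ℝ} (ha : 0 < a) (hb : 0 < b) :
    IntegrableOn (fun s : ℝ => (1 - s) ^ (a - 1) * s ^ (b - 1)) (Set.Ioo 0 1) volume := by
  have := Complex.betaIntegral_convergent (u := b) (v := a) (by simpa) (by simpa)
  rw [intervalIntegrable_iff_integrableOn_Ioo_of_le zero_le_one] at this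
  refine IntegrableOn.congr_fun this.re ?_ measurableSet_Ioo
  intro s hs
  have h1 : 0 ≤ 1 - s := by linarith [hs.2]
  have h : ((s : ℂ) ^ ((b : ℂ) - 1) * (1 - (s : ℂ)) ^ ((a : ℂ) - 1))
      = (((1 - s) ^ (a - 1) * s ^ (b - 1) : ℝ) : ℂ) := by
    push_cast
    rw [Complex.ofReal_cpow hs.1.le, Complex.ofReal_cpow h1]
    push_cast
    ring
  simp only [h]
  simp

lemma betaFn_eq (a b : ℝ) :
    betaFn a b = ∫ s in Set.Ioo (0 : ℝ) 1, (1 - s) ^ (a - 1) * s ^ (b - 1) := by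
  rw [betaFn, intervalIntegral.integral_of_le zero_le_one, integral_Ioc_eq_integral_Ioo]

lemma betaFn_nonneg (a b : ℝ) : 0 ≤ betaFn a b := by
  rw [betaFn_eq]
  refine setIntegral_nonneg measurableSet_Ioo fun s hs => ?_
  have h1 : 0 ≤ 1 - s := by linarith [hs.2]
  have := hs.1
  positivity

lemma lintegral_affine {E : Type*} [NormedAddCommGroup E] [NormedSpace ℝ E] [MeasurableSpace E]
    [BorelSpace E] [FiniteDimensional ℝ E] (μ : Measure E) [μ.IsAddHaarMeasure] (a : E) (c : ℝ)
    (hc : 0 < c) (f : E → ℝ≥0∞) (hf : Measurable f) :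
    ENNReal.ofReal (c ^ Module.finrank ℝ E) * ∫⁻ p, f (a + c • p) ∂μ = ∫⁻ y, f y ∂μ := by
  have h1 : ∫⁻ p, f (a + c • p) ∂μ = ∫⁻ y, f (a + y) ∂(μ.map (fun x => c • x)) := by
    rw [lintegral_map (by fun_prop) (by fun_prop)]
  rw [h1, Measure.map_addHaar_smul μ hc.ne', lintegral_smul_measure,
    lintegral_add_left_eq_self f a, abs_of_pos (by positivity), smul_eq_mul, ← mul_assoc,
    ← ENNReal.ofReal_mul (by positivity), mul_inv_cancel₀ (by positivity)]
  simp

/-- The change of variables `(θ, p) ↦ (s, y)`. -/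
noncomputable def cov (t u : ℝ) (x v : Fin d → ℝ) (z : ℝ × (Fin d → ℝ)) : ℝ × (Fin d → ℝ) :=
  (t + u ^ 2 * z.1, x + u • (z.1 • v + (√z.1 * √(1 - z.1)) • z.2))

lemma continuous_cov (t u : ℝ) (x v : Fin d → ℝ) : Continuous (cov t u x v) := by
  unfold cov; fun_prop

noncomputable def jac (d : ℕ) (u θ : ℝ) : ℝ := u ^ 2 * (u * (√θ * √(1 - θ))) ^ d

lemma cov_lintegral (t u : ℝ) (hu : 0 < u) (x v : Fin d → ℝ)
    (f : ℝ × (Fin d → ℝ) → ℝ≥0∞) (hf : Measurable f) :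
    ∫⁻ z, ENNReal.ofReal (jac d u z.1) * f (cov t u x v z)
        ∂((volume.restrict (Set.Ioo (0 : ℝ) 1)).prod volume) =
      ∫⁻ y, f y ∂((volume.restrict (Set.Ioo t (t + u ^ 2))).prod volume) := by
  have hm : Measurable (fun z : ℝ × (Fin d → ℝ) =>
      ENNReal.ofReal (jac d u z.1) * f (cov t u x v z)) := by
    have h1 := (continuous_cov t u x v).measurable
    have h2 : Continuous (fun z : ℝ × (Fin d → ℝ) => jac d u z.1) := by unfold jac; fun_prop
    exact h2.measurable.ennreal_ofReal.mul (hf.comp h1)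
  rw [lintegral_prod _ hm.aemeasurable, lintegral_prod _ hf.aemeasurable]
  set g : ℝ → ℝ≥0∞ := fun s => ∫⁻ y, f (s, y) with hg
  have hgm : Measurable g := hf.lintegral_prod_right'
  rw [← lintegral_indicator measurableSet_Ioo, ← lintegral_indicator measurableSet_Ioo]
  rw [← lintegral_affine volume t (u ^ 2) (by positivity) _ (hgm.indicator measurableSet_Ioo),
    ← lintegral_const_mul' _ _ ENNReal.ofReal_ne_top]
  refine lintegral_congr fun θ => ?_
  have hiff : t + u ^ 2 • θ ∈ Set.Ioo t (t + u ^ 2) ↔ θ ∈ Set.Ioo (0 : ℝ) 1 := by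
    have : 0 < u ^ 2 := by positivity
    simp only [Set.mem_Ioo, smul_eq_mul, lt_add_iff_pos_right, add_lt_add_iff_left]
    rw [mul_pos_iff_of_pos_left this, mul_lt_iff_lt_one_right this]
  by_cases hθ : θ ∈ Set.Ioo (0 : ℝ) 1
  · rw [Set.indicator_of_mem hθ, Set.indicator_of_mem (hiff.2 hθ)]
    have h1 : 0 < 1 - θ := by linarith [hθ.2]
    have h0 := hθ.1
    have hc : 0 < u * (√θ * √(1 - θ)) := by positivity
    have key := lintegral_affine (volume : Measure (Fin d → ℝ)) (x + u • θ • v) _ hc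
      (fun y => f (t + u ^ 2 * θ, y)) (by fun_prop)
    rw [hg]
    simp only [smul_eq_mul] at *
    rw [← key, Module.finrank_fin_fun, Module.finrank_self, pow_one, ← mul_assoc,
      ← ENNReal.ofReal_mul (by positivity), lintegral_const_mul' _ _ ENNReal.ofReal_ne_top, jac]
    congr 1
    refine lintegral_congr fun p => ?_
    simp only [cov, smul_add, smul_smul, add_assoc]
  · rw [Set.indicator_of_notMem hθ, Set.indicator_of_notMem (fun h => hθ (hiff.1 h)), mul_zero]

lemma cov_integral (t u : ℝ) (hu : 0 < u) (x v : Fin d → ℝ)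
    (f : ℝ × (Fin d → ℝ) → ℝ) (hf : Measurable f) :
    ∫ y, f y ∂((volume.restrict (Set.Ioo t (t + u ^ 2))).prod volume) =
    ∫ z, jac d u z.1 * f (cov t u x v z)
        ∂((volume.restrict (Set.Ioo (0 : ℝ) 1)).prod volume) := by
  have h1 := (continuous_cov t u x v).measurable
  have h2 : Continuous (fun z : ℝ × (Fin d → ℝ) => jac d u z.1) := by unfold jac; fun_prop
  have h3 := h2.measurable.ennreal_ofReal
  have hmap : (((volume.restrict (Set.Ioo (0 : ℝ) 1)).prod volume).withDensity
      (fun z : ℝ × (Fin d → ℝ) => ENNReal.ofReal (jac d u z.1))).map (cov t u x v) =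
      (volume.restrict (Set.Ioo t (t + u ^ 2))).prod volume := by
    refine Measure.ext_of_lintegral _ fun g hg => ?_
    rw [lintegral_map hg h1, ← cov_lintegral t u hu x v g hg]
    exact lintegral_withDensity_eq_lintegral_mul _ h3 (hg.comp h1)
  rw [← hmap, integral_map h1.aemeasurable hf.aestronglyMeasurable,
    integral_withDensity_eq_integral_toReal_smul h3 (ae_of_all _ fun _ => ENNReal.ofReal_lt_top)]
  refine integral_congr_ae (ae_of_all _ fun z => ?_)
  simp only [smul_eq_mul]
  rw [ENNReal.toReal_ofReal]
  unfold jac; positivity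

lemma integral_pt (f : Pt d → ℝ) :
    ∫ ζ : Pt d, f ζ = ∫ y : ℝ × (Fin d → ℝ), f (Fin.cons y.1 y.2) ∂(volume.prod volume) := by
  have := (volume_preserving_piFinSuccAbove (fun _ : Fin (d + 1) => ℝ) 0).integral_comp'
    (fun y => f (Fin.cons y.1 y.2))
  rw [← Measure.volume_eq_prod, ← this]
  refine integral_congr_ae (ae_of_all _ fun z => ?_)
  simp only [MeasurableEquiv.piFinSuccAbove_apply, Fin.insertNthEquiv_zero]
  congr 1
  ext i
  refine Fin.cases ?_ (fun j => ?_) i <;> simp [Fin.consEquiv, Fin.tail]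

lemma mderiv_zero (f : Pt d → ℝ) : mderiv 0 f = f := by
  unfold mderiv
  induction List.finRange (d + 1) with
  | nil => rfl
  | cons a l ih => simp

lemma mderiv2_zero {j m : Fin (d + 1) → ℕ} (h : pdeg j + ∑ i, m i ≤ 0) (F : Pt d → Pt d → ℝ) :
    mderiv2 j m F = F := by
  have hj : j = 0 := by
    funext i
    have : j i ≤ ∑ i, j i := Finset.single_le_sum (fun _ _ => Nat.zero_le _) (Finset.mem_univ i)
    simp only [pdeg] at h
    simp only [Pi.zero_apply]
    omega
  have hm : m = 0 := by
    funext i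
    have : m i ≤ ∑ i, m i := Finset.single_le_sum (fun _ _ => Nat.zero_le _) (Finset.mem_univ i)
    simp only [Pi.zero_apply]
    omega
  subst hj hm
  funext z zb
  simp only [mderiv2, mderiv_zero]

lemma psiSmooth_zero (Ft : Pt d → Pt d → ℝ) :
    PsiSmooth 0 Ft ↔ Continuous (fun p : Pt d × Pt d => Ft p.1 p.2) := by
  constructor
  · intro h
    have h0 : pdeg (0 : Fin (d + 1) → ℕ) + ∑ i, (0 : Fin (d + 1) → ℕ) i ≤ 0 := by simp [pdeg]
    have := h.2 0 0 h0
    rwa [mderiv2_zero h0] at this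
  · intro h
    refine ⟨fun j m hjm => absurd hjm (Nat.not_lt_zero _), fun j m hjm => ?_⟩
    rwa [mderiv2_zero hjm]

lemma psiSet_zero (T : ℝ) (n : ℕ) (Ft : Pt d → Pt d → ℝ) :
    psiSet 0 T n Ft = {y | ∃ w uv : Pt d, 0 ≤ uv 0 ∧ uv 0 ≤ √T ∧
      y = (1 + nv (Fin.tail uv)) ^ n * |Ft w uv|} := by
  ext y
  constructor
  · rintro ⟨j, m, w, uv, hjm, h0, h1, rfl⟩
    exact ⟨w, uv, h0, h1, by rw [mderiv2_zero hjm]; rfl⟩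
  · rintro ⟨w, uv, h0, h1, rfl⟩
    have hz : pdeg (0 : Fin (d + 1) → ℕ) + ∑ i, (0 : Fin (d + 1) → ℕ) i ≤ 0 := by simp [pdeg]
    exact ⟨0, 0, w, uv, hz, h0, h1, by rw [mderiv2_zero hz]; rfl⟩

/-- Weighted bound on a representation. -/
def Bd (T : ℝ) (n : ℕ) (A : ℝ) (Ft : Pt d → Pt d → ℝ) : Prop :=
  ∀ w uv : Pt d, 0 ≤ uv 0 → uv 0 ≤ √T → (1 + nv (Fin.tail uv)) ^ n * |Ft w uv| ≤ A

lemma bddAbove_iff (T : ℝ) (n : ℕ) (Ft : Pt d → Pt d → ℝ) :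
    BddAbove (psiSet 0 T n Ft) ↔ ∃ A, Bd T n A Ft := by
  rw [psiSet_zero]
  constructor
  · rintro ⟨A, hA⟩
    exact ⟨A, fun w uv h0 h1 => hA ⟨w, uv, h0, h1, rfl⟩⟩
  · rintro ⟨A, hA⟩
    refine ⟨A, ?_⟩
    rintro y ⟨w, uv, h0, h1, rfl⟩
    exact hA w uv h0 h1

lemma psiSet_nonempty (T : ℝ) (n : ℕ) (Ft : Pt d → Pt d → ℝ) :
    (psiSet 0 T n Ft).Nonempty := by
  rw [psiSet_zero]
  exact ⟨_, 0, 0, le_rfl, Real.sqrt_nonneg _, rfl⟩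

lemma Bd.nonneg {T : ℝ} {n : ℕ} {A : ℝ} {Ft : Pt d → Pt d → ℝ} (h : Bd T n A Ft) : 0 ≤ A := by
  refine le_trans ?_ (h 0 0 le_rfl (Real.sqrt_nonneg _))
  have := nv_nonneg (Fin.tail (0 : Pt d))
  positivity

lemma Bd.le {T : ℝ} {n : ℕ} {A : ℝ} {Ft : Pt d → Pt d → ℝ} (h : Bd T n A Ft) (w uv : Pt d)
    (h0 : 0 ≤ uv 0) (h1 : uv 0 ≤ √T) : |Ft w uv| ≤ A * ((1 + nv (Fin.tail uv)) ^ n)⁻¹ := by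
  have := h w uv h0 h1
  have h2 : 0 < (1 + nv (Fin.tail uv)) ^ n := by
    have := nv_nonneg (Fin.tail uv)
    positivity
  rw [← div_eq_mul_inv, le_div_iff₀ h2]
  linarith

lemma bd_sSup {T : ℝ} {n : ℕ} {Ft : Pt d → Pt d → ℝ} (h : BddAbove (psiSet 0 T n Ft)) :
    Bd T n (sSup (psiSet 0 T n Ft)) Ft := by
  intro w uv h0 h1
  refine le_csSup h ?_
  rw [psiSet_zero]
  exact ⟨w, uv, h0, h1, rfl⟩

lemma sSup_le_of_bd {T : ℝ} {n : ℕ} {A : ℝ} {Ft : Pt d → Pt d → ℝ} (h : Bd T n A Ft) :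
    sSup (psiSet 0 T n Ft) ≤ A := by
  refine csSup_le (psiSet_nonempty T n Ft) ?_
  rw [psiSet_zero]
  rintro y ⟨w, uv, h0, h1, rfl⟩
  exact h w uv h0 h1

lemma rep_unique_pos {α : ℝ} {F Ft Gt : Pt d → Pt d → ℝ} (h1 : PsiRep α Ft F)
    (h2 : PsiRep α Gt F) (w uv : Pt d) (hu : 0 < uv 0) : Ft w uv = Gt w uv := by
  set z : Pt d := Fin.cons (w 0 + uv 0 ^ 2) (fun i => w i.succ + uv 0 * uv i.succ) with hz
  have e := (h1 z w).symm.trans (h2 z w)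
  have hz0 : z 0 - w 0 = uv 0 ^ 2 := by simp [hz]
  have hlt : w 0 < z 0 := by
    have : 0 < uv 0 ^ 2 := by positivity
    linarith
  rw [if_pos hlt, if_pos hlt, hz0, Real.sqrt_sq hu.le] at e
  have hc : (Fin.cons (uv 0) (fun i : Fin d => (z i.succ - w i.succ) / uv 0) : Pt d) = uv := by
    ext i
    refine Fin.cases ?_ (fun j => ?_) i
    · simp
    · simp only [Fin.cons_succ, hz]
      field_simp
      ring
  rw [hc] at e
  have hp : (0 : ℝ) < (uv 0 ^ 2) ^ ((α - d - 2) / 2) := by positivity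
  exact mul_left_cancel₀ hp.ne' e

lemma rep_unique {α : ℝ} {F Ft Gt : Pt d → Pt d → ℝ} (h1 : PsiRep α Ft F)
    (h2 : PsiRep α Gt F) (c1 : Continuous (fun p : Pt d × Pt d => Ft p.1 p.2))
    (c2 : Continuous (fun p : Pt d × Pt d => Gt p.1 p.2)) (w uv : Pt d) (hu : 0 ≤ uv 0) :
    Ft w uv = Gt w uv := by
  have hcl : IsClosed {uv : Pt d | Ft w uv = Gt w uv} := by
    refine isClosed_eq ?_ ?_
    · exact c1.comp (Continuous.prodMk_right w)
    · exact c2.comp (Continuous.prodMk_right w)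
  have ht : Tendsto (fun s : ℝ => uv + Pi.single 0 s) (nhdsWithin 0 (Set.Ioi 0)) (nhds uv) := by
    have : Continuous (fun s : ℝ => uv + Pi.single (M := fun _ : Fin (d + 1) => ℝ) 0 s) :=
      continuous_const.add
        (continuous_single (A := fun _ : Fin (d + 1) => ℝ) (0 : Fin (d + 1)))
    have h := (this.tendsto 0).mono_left (nhdsWithin_le_nhds (s := Set.Ioi 0))
    simpa using h
  refine hcl.mem_of_tendsto ht ?_
  filter_upwards [self_mem_nhdsWithin] with s hs
  refine rep_unique_pos h1 h2 _ _ ?_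
  simp only [Pi.add_apply, Pi.single_eq_same]
  have : 0 < s := hs
  linarith

lemma psiNorm_eq {α T : ℝ} {n : ℕ} {F Ft : Pt d → Pt d → ℝ} (h1 : PsiRep α Ft F)
    (hs : PsiSmooth 0 Ft) (hb : BddAbove (psiSet 0 T n Ft)) :
    psiNorm α 0 T n F = sSup (psiSet 0 T n Ft) := by
  have : {y | ∃ Ft, PsiRep α Ft F ∧ PsiSmooth 0 Ft ∧ BddAbove (psiSet 0 T n Ft) ∧
    y = sSup (psiSet 0 T n Ft)} = {sSup (psiSet 0 T n Ft)} := by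
    ext y
    simp only [Set.mem_ofPred_eq, Set.mem_singleton_iff]
    constructor
    · rintro ⟨Gt, g1, gs, gb, rfl⟩
      congr 1
      rw [psiSet_zero, psiSet_zero]
      ext y
      have hu := rep_unique g1 h1 ((psiSmooth_zero _).1 gs) ((psiSmooth_zero _).1 hs)
      constructor
      · rintro ⟨w, uv, h0, h1, rfl⟩
        exact ⟨w, uv, h0, h1, by rw [hu w uv h0]⟩
      · rintro ⟨w, uv, h0, h1, rfl⟩
        exact ⟨w, uv, h0, h1, by rw [hu w uv h0]⟩
    · rintro rfl
      exact ⟨Ft, h1, hs, hb, rfl⟩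
  rw [psiNorm, this, csInf_singleton]

/-- The reference measure on `(0,1) × ℝ^d`. -/
noncomputable def mu0 (d : ℕ) : Measure (ℝ × (Fin d → ℝ)) :=
  (volume.restrict (Set.Ioo (0 : ℝ) 1)).prod volume

lemma ae_mu0 : ∀ᵐ x ∂(mu0 d), x.1 ∈ Set.Ioo (0 : ℝ) 1 :=
  Measure.quasiMeasurePreserving_fst.ae (ae_restrict_mem measurableSet_Ioo)

noncomputable def core (Ft Gt : Pt d → Pt d → ℝ) (w uv : Pt d) (x : ℝ × (Fin d → ℝ)) : ℝ :=
  Ft (Fin.cons (cov (w 0) |uv 0| (Fin.tail w) (Fin.tail uv) x).1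
        (cov (w 0) |uv 0| (Fin.tail w) (Fin.tail uv) x).2)
      (Fin.cons (|uv 0| * √(1 - x.1)) (√(1 - x.1) • Fin.tail uv + (-√x.1) • x.2)) *
    Gt w (Fin.cons (|uv 0| * √x.1) (√x.1 • Fin.tail uv + √(1 - x.1) • x.2))

noncomputable def wt (α β θ : ℝ) : ℝ := (1 - θ) ^ (α / 2 - 1) * θ ^ (β / 2 - 1)

lemma measurable_wt (α β : ℝ) : Measurable (wt α β) := by unfold wt; fun_prop

lemma wt_nonneg {α β θ : ℝ} (h : θ ∈ Set.Ioo (0 : ℝ) 1) : 0 ≤ wt α β θ := by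
  have h1 : 0 ≤ 1 - θ := by linarith [h.2]
  have := h.1
  unfold wt
  positivity

noncomputable def Ht (α β : ℝ) (Ft Gt : Pt d → Pt d → ℝ) (w uv : Pt d) : ℝ :=
  ∫ x, wt α β x.1 * core Ft Gt w uv x ∂(mu0 d)

lemma continuous_core {Ft Gt : Pt d → Pt d → ℝ}
    (c1 : Continuous (fun p : Pt d × Pt d => Ft p.1 p.2))
    (c2 : Continuous (fun p : Pt d × Pt d => Gt p.1 p.2)) :
    Continuous (fun q : (Pt d × Pt d) × (ℝ × (Fin d → ℝ)) => core Ft Gt q.1.1 q.1.2 q.2) := by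
  have ht1 : Continuous (fun q : (Pt d × Pt d) × (ℝ × (Fin d → ℝ)) =>
      (Fin.tail q.1.1 : Fin d → ℝ)) := continuous_pi fun i => by simp only [Fin.tail]; fun_prop
  have ht2 : Continuous (fun q : (Pt d × Pt d) × (ℝ × (Fin d → ℝ)) =>
      (Fin.tail q.1.2 : Fin d → ℝ)) := continuous_pi fun i => by simp only [Fin.tail]; fun_prop
  unfold core cov
  refine Continuous.mul ?_ ?_
  · refine c1.comp (Continuous.prodMk ?_ ?_)
    · exact Continuous.finCons (A := fun _ => ℝ) (by fun_prop) (by fun_prop)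
    · exact Continuous.finCons (A := fun _ => ℝ) (by fun_prop) (by fun_prop)
  · have hw : Continuous (fun q : (Pt d × Pt d) × (ℝ × (Fin d → ℝ)) => q.1.1) := by fun_prop
    have hc : Continuous (fun q : (Pt d × Pt d) × (ℝ × (Fin d → ℝ)) =>
        (Fin.cons (|q.1.2 0| * √q.2.1) (√q.2.1 • Fin.tail q.1.2 + √(1 - q.2.1) • q.2.2) :
          Pt d)) :=
      Continuous.finCons (A := fun _ => ℝ) (by fun_prop) (by fun_prop)
    exact c2.comp (hw.prodMk hc)

/-- Bound of the core by the product of the two decay factors. -/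
lemma core_bound {T : ℝ} {n m : ℕ} {A B : ℝ} {Ft Gt : Pt d → Pt d → ℝ} (hF : Bd T n A Ft)
    (hG : Bd T m B Gt) (w uv : Pt d) (hu : |uv 0| ≤ √T) (x : ℝ × (Fin d → ℝ))
    (hx : x.1 ∈ Set.Ioo (0 : ℝ) 1) :
    |core Ft Gt w uv x| ≤
      A * ((1 + nv (√(1 - x.1) • Fin.tail uv + (-√x.1) • x.2)) ^ n)⁻¹ *
      (B * ((1 + nv (√x.1 • Fin.tail uv + √(1 - x.1) • x.2)) ^ m)⁻¹) := by
  have hs1 : √x.1 ≤ 1 := Real.sqrt_le_one.2 hx.2.le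
  have hs2 : √(1 - x.1) ≤ 1 := Real.sqrt_le_one.2 (by linarith [hx.1])
  rw [core, abs_mul]
  refine mul_le_mul ?_ ?_ (abs_nonneg _) ?_
  · refine (hF.le _ _ ?_ ?_).trans_eq ?_
    · simp only [Fin.cons_zero]; positivity
    · simp only [Fin.cons_zero]
      exact (mul_le_of_le_one_right (abs_nonneg _) hs2).trans hu
    · simp
  · refine (hG.le _ _ ?_ ?_).trans_eq ?_
    · simp only [Fin.cons_zero]; positivity
    · simp only [Fin.cons_zero]
      exact (mul_le_of_le_one_right (abs_nonneg _) hs1).trans hu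
    · simp
  · have := hF.nonneg
    have := nv_nonneg (√(1 - x.1) • Fin.tail uv + (-√x.1) • x.2)
    positivity

lemma sqrt_facts {θ : ℝ} (h : θ ∈ Set.Ioo (0 : ℝ) 1) :
    0 < √θ ∧ 0 < √(1 - θ) ∧ √θ * √θ = θ ∧ √(1 - θ) * √(1 - θ) = 1 - θ ∧ |√θ| ≤ 1 ∧
      |√(1 - θ)| ≤ 1 := by
  have h0 := h.1
  have h1 : 0 < 1 - θ := by linarith [h.2]
  refine ⟨Real.sqrt_pos.2 h0, Real.sqrt_pos.2 h1, Real.mul_self_sqrt h0.le,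
    Real.mul_self_sqrt h1.le, ?_, ?_⟩
  · rw [abs_of_nonneg (Real.sqrt_nonneg _)]; exact Real.sqrt_le_one.2 h.2.le
  · rw [abs_of_nonneg (Real.sqrt_nonneg _)]; exact Real.sqrt_le_one.2 (by linarith)

lemma decay_v (v p : Fin d → ℝ) {θ : ℝ} (h : θ ∈ Set.Ioo (0 : ℝ) 1) :
    1 + nv v ≤ (1 + nv (√(1 - θ) • v + (-√θ) • p)) * (1 + nv (√θ • v + √(1 - θ) • p)) := by
  obtain ⟨-, -, h1, h2, h3, h4⟩ := sqrt_facts h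
  refine one_add_nv_le (√(1 - θ)) (√θ) h4 h3 _ _ _ ?_
  ext i
  simp only [Pi.add_apply, Pi.smul_apply, smul_eq_mul]
  linear_combination (-v i) * h1 + (-v i) * h2

lemma decay_p (v p : Fin d → ℝ) {θ : ℝ} (h : θ ∈ Set.Ioo (0 : ℝ) 1) :
    1 + nv p ≤ (1 + nv (√(1 - θ) • v + (-√θ) • p)) * (1 + nv (√θ • v + √(1 - θ) • p)) := by
  obtain ⟨-, -, h1, h2, h3, h4⟩ := sqrt_facts h
  refine one_add_nv_le (-√θ) (√(1 - θ)) (by rwa [abs_neg]) h4 _ _ _ ?_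
  ext i
  simp only [Pi.add_apply, Pi.smul_apply, smul_eq_mul]
  linear_combination (-p i) * h1 + (-p i) * h2

/-- Uniform domination, used for stability and continuity. -/
lemma core_dom {T : ℝ} {n : ℕ} {A B : ℝ} {Ft Gt : Pt d → Pt d → ℝ}
    (hF : Bd T (n + (d + 1)) A Ft)
    (hG : Bd T (n + (d + 1)) B Gt) (w uv : Pt d) (hu : |uv 0| ≤ √T) (x : ℝ × (Fin d → ℝ))
    (hx : x.1 ∈ Set.Ioo (0 : ℝ) 1) :
    |core Ft Gt w uv x| ≤ A * B * ((1 + nv (Fin.tail uv)) ^ n)⁻¹ * prof x.2 := by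
  refine (core_bound hF hG w uv hu x hx).trans ?_
  have hv := decay_v (Fin.tail uv) x.2 hx
  have hp := decay_p (Fin.tail uv) x.2 hx
  set a := nv (√(1 - x.1) • Fin.tail uv + (-√x.1) • x.2) with ha
  set b := nv (√x.1 • Fin.tail uv + √(1 - x.1) • x.2) with hb
  have ha0 : 0 ≤ a := nv_nonneg _
  have hb0 : 0 ≤ b := nv_nonneg _
  have hA := hF.nonneg
  have hB := hG.nonneg
  have hv0 := nv_nonneg (Fin.tail uv)
  have hp0 := nv_nonneg x.2
  calc _ = A * B * (((1 + a) * (1 + b)) ^ n)⁻¹ * (((1 + a) * (1 + b)) ^ (d + 1))⁻¹ := by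
        rw [pow_add (1 + a) n, pow_add (1 + b) n, mul_pow, mul_pow]; simp only [mul_inv]; ring
    _ ≤ A * B * ((1 + nv (Fin.tail uv)) ^ n)⁻¹ * ((1 + nv x.2) ^ (d + 1))⁻¹ := by gcongr
    _ ≤ _ := by
      refine mul_le_mul_of_nonneg_left (prof_bound _) (by positivity)

lemma aesm_integrand (α β : ℝ) {Ft Gt : Pt d → Pt d → ℝ}
    (c1 : Continuous (fun p : Pt d × Pt d => Ft p.1 p.2))
    (c2 : Continuous (fun p : Pt d × Pt d => Gt p.1 p.2)) (w uv : Pt d) :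
    AEStronglyMeasurable (fun x => wt α β x.1 * core Ft Gt w uv x) (mu0 d) := by
  have := (continuous_core c1 c2).comp (Continuous.prodMk_right (w, uv))
  exact (((measurable_wt α β).comp measurable_fst).mul this.measurable).aestronglyMeasurable

lemma integrable_wt {α β : ℝ} (hα : 0 < α) (hβ : 0 < β) :
    Integrable (wt α β) (volume.restrict (Set.Ioo (0 : ℝ) 1)) :=
  beta_integrable (half_pos hα) (half_pos hβ)

lemma integrable_dom {α β : ℝ} (hα : 0 < α) (hβ : 0 < β) (K : ℝ) :
    Integrable (fun x => wt α β x.1 * (K * prof x.2)) (mu0 d) :=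
  (integrable_wt hα hβ).mul_prod (integrable_prof.const_mul K)

lemma integrand_dom (α β : ℝ) {T : ℝ} {n : ℕ} {A B : ℝ} {Ft Gt : Pt d → Pt d → ℝ}
    (hF : Bd T (n + (d + 1)) A Ft)
    (hG : Bd T (n + (d + 1)) B Gt) (w uv : Pt d) (hu : |uv 0| ≤ √T) :
    ∀ᵐ x ∂(mu0 d), ‖wt α β x.1 * core Ft Gt w uv x‖ ≤
      wt α β x.1 * (A * B * ((1 + nv (Fin.tail uv)) ^ n)⁻¹ * prof x.2) := by
  filter_upwards [ae_mu0] with x hx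
  rw [norm_mul, Real.norm_eq_abs, Real.norm_eq_abs, abs_of_nonneg (wt_nonneg hx)]
  exact mul_le_mul_of_nonneg_left (core_dom hF hG w uv hu x hx) (wt_nonneg hx)

lemma Ht_continuous {α β : ℝ} (hα : 0 < α) (hβ : 0 < β) {Ft Gt : Pt d → Pt d → ℝ}
    (c1 : Continuous (fun p : Pt d × Pt d => Ft p.1 p.2))
    (c2 : Continuous (fun p : Pt d × Pt d => Gt p.1 p.2))
    (b1 : ∀ T : ℝ, 0 < T → ∀ n : ℕ, ∃ A, Bd T n A Ft)
    (b2 : ∀ T : ℝ, 0 < T → ∀ n : ℕ, ∃ A, Bd T n A Gt) :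
    Continuous (fun p : Pt d × Pt d => Ht α β Ft Gt p.1 p.2) := by
  rw [continuous_iff_continuousAt]
  rintro ⟨w₀, uv₀⟩
  have hT : 0 < (|uv₀ 0| + 1) ^ 2 := by positivity
  obtain ⟨A, hA⟩ := b1 _ hT (0 + (d + 1))
  obtain ⟨B, hB⟩ := b2 _ hT (0 + (d + 1))
  unfold Ht
  refine continuousAt_of_dominated (bound := fun x => wt α β x.1 * (A * B * prof x.2))
    (Eventually.of_forall fun p => aesm_integrand α β c1 c2 _ _) ?_ (integrable_dom hα hβ _) ?_
  · have hc : Continuous (fun p : Pt d × Pt d => |p.2 0|) := by fun_prop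
    have : ∀ᶠ p : Pt d × Pt d in nhds (w₀, uv₀), |p.2 0| < |uv₀ 0| + 1 :=
      hc.continuousAt.eventually_lt continuousAt_const (by simp)
    filter_upwards [this] with p hp
    have h := integrand_dom α β hA hB p.1 p.2 (by rw [Real.sqrt_sq (by positivity)]; exact hp.le)
    simpa using h
  · refine ae_of_all _ fun x => ?_
    have := (continuous_core c1 c2).comp (Continuous.prodMk_left x)
    exact (continuous_const.mul this).continuousAt

lemma Ht_bd {α β : ℝ} (hα : 0 < α) (hβ : 0 < β) {Ft Gt : Pt d → Pt d → ℝ}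
    {T : ℝ} {n : ℕ} {A B : ℝ}
    (hF : Bd T (n + (d + 1)) A Ft) (hG : Bd T (n + (d + 1)) B Gt) :
    ∃ K, Bd T n K (Ht α β Ft Gt) := by
  refine ⟨∫ x, wt α β x.1 * (A * B * prof x.2) ∂(mu0 d), fun w uv h0 h1 => ?_⟩
  have := norm_integral_le_of_norm_le (integrable_dom hα hβ _)
    (integrand_dom α β hF hG w uv (by rwa [abs_of_nonneg h0]))
  have hv := nv_nonneg (Fin.tail uv)
  have hpos : 0 < (1 + nv (Fin.tail uv)) ^ n := by positivity
  have e : ∫ x, wt α β x.1 * (A * B * ((1 + nv (Fin.tail uv)) ^ n)⁻¹ * prof x.2) ∂(mu0 d) =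
      ((1 + nv (Fin.tail uv)) ^ n)⁻¹ * ∫ x, wt α β x.1 * (A * B * prof x.2) ∂(mu0 d) := by
    rw [← integral_const_mul]
    congr 1
    ext x
    ring
  rw [e] at this
  rw [← Real.norm_eq_abs, Ht]
  rwa [mul_comm, ← le_div_iff₀ hpos, div_eq_inv_mul]

lemma Ht_bd_sharp {α β : ℝ} (hα : (d : ℝ) < α) (hβ : 0 < β) {Ft Gt : Pt d → Pt d → ℝ}
    (c1 : Continuous (fun p : Pt d × Pt d => Ft p.1 p.2))
    (c2 : Continuous (fun p : Pt d × Pt d => Gt p.1 p.2))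
    (b1 : ∀ T : ℝ, 0 < T → ∀ n : ℕ, ∃ A, Bd T n A Ft)
    (b2 : ∀ T : ℝ, 0 < T → ∀ n : ℕ, ∃ A, Bd T n A Gt)
    {T : ℝ} (hT : 0 < T) {n : ℕ} {A B : ℝ}
    (hF : Bd T n A Ft) (hG : Bd T (n + (d + 1)) B Gt) :
    Bd T n ((∫ q : Fin d → ℝ, prof q) * A * B * betaFn ((α - d) / 2) (β / 2))
      (Ht α β Ft Gt) := by
  intro w uv h0 h1
  have hu : |uv 0| ≤ √T := by rwa [abs_of_nonneg h0]
  have hα0 : 0 < α := lt_of_le_of_lt (Nat.cast_nonneg d) hα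
  have hA := hF.nonneg
  have hB := hG.nonneg
  have hv := nv_nonneg (Fin.tail uv)
  have hpos : 0 < (1 + nv (Fin.tail uv)) ^ n := by positivity
  set I := ∫ q : Fin d → ℝ, prof q with hI
  set D := A * B * ((1 + nv (Fin.tail uv)) ^ n)⁻¹ with hD
  have hint : Integrable (fun x => wt α β x.1 * core Ft Gt w uv x) (mu0 d) := by
    obtain ⟨A', hA'⟩ := b1 T hT (0 + (d + 1))
    obtain ⟨B', hB'⟩ := b2 T hT (0 + (d + 1))
    exact (integrable_dom hα0 hβ _).mono' (aesm_integrand α β c1 c2 w uv)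
      (integrand_dom α β hA' hB' w uv hu)
  have hle : |Ht α β Ft Gt w uv| ≤ ∫ θ in Set.Ioo (0 : ℝ) 1,
      I * D * ((1 - θ) ^ ((α - d) / 2 - 1) * θ ^ (β / 2 - 1)) := by
    rw [← Real.norm_eq_abs, Ht]
    unfold mu0 at hint ⊢
    rw [integral_prod _ hint]
    refine norm_integral_le_of_norm_le ?_ ?_
    · exact (beta_integrable (by linarith) (half_pos hβ)).const_mul _
    · filter_upwards [ae_restrict_mem measurableSet_Ioo] with θ hθ
      obtain ⟨s0, s1, -, -, -, -⟩ := sqrt_facts hθ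
      have hθ1 : 0 < 1 - θ := by linarith [hθ.2]
      have hb : ∀ p : Fin d → ℝ, ‖wt α β θ * core Ft Gt w uv (θ, p)‖ ≤
          wt α β θ * D * prof (√θ • Fin.tail uv + √(1 - θ) • p) := by
        intro p
        rw [norm_mul, Real.norm_eq_abs, Real.norm_eq_abs, abs_of_nonneg (wt_nonneg hθ), mul_assoc]
        refine mul_le_mul_of_nonneg_left ?_ (wt_nonneg hθ)
        refine (core_bound hF hG w uv hu (θ, p) hθ).trans ?_
        have hv := decay_v (Fin.tail uv) p hθ
        simp only
        set a := nv (√(1 - θ) • Fin.tail uv + (-√θ) • p) with ha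
        set q := √θ • Fin.tail uv + √(1 - θ) • p with hq
        have ha0 : 0 ≤ a := nv_nonneg _
        have hb0 : 0 ≤ nv q := nv_nonneg _
        calc _ = A * B * (((1 + a) * (1 + nv q)) ^ n)⁻¹ * ((1 + nv q) ^ (d + 1))⁻¹ := by
              rw [pow_add, mul_pow]; simp only [mul_inv]; ring
          _ ≤ A * B * ((1 + nv (Fin.tail uv)) ^ n)⁻¹ * ((1 + nv q) ^ (d + 1))⁻¹ := by gcongr
          _ ≤ _ := mul_le_mul_of_nonneg_left (prof_bound _) (by positivity)
      refine (norm_integral_le_of_norm_le ((integrable_prof_affine _ _ s1).const_mul _)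
        (ae_of_all _ hb)).trans_eq ?_
      rw [integral_const_mul, integral_prof_affine _ _ s1, ← hI, wt]
      have : (1 - θ) ^ ((α - d) / 2 - 1) = (1 - θ) ^ (α / 2 - 1) * (√(1 - θ) ^ d)⁻¹ := by
        rw [Real.sqrt_eq_rpow, ← Real.rpow_natCast, ← Real.rpow_mul hθ1.le,
          ← Real.rpow_neg hθ1.le, ← Real.rpow_add hθ1]
        congr 1
        ring
      rw [this]
      ring
  rw [integral_const_mul, ← betaFn_eq] at hle
  calc _ ≤ (1 + nv (Fin.tail uv)) ^ n * (I * D * betaFn ((α - d) / 2) (β / 2)) := by gcongr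
    _ = _ := by rw [hD]; field_simp

lemma measurable_finCons {X : Type*} [MeasurableSpace X] {f : X → ℝ} {g : X → Fin d → ℝ}
    (hf : Measurable f) (hg : Measurable g) :
    Measurable (fun x => (Fin.cons (f x) (g x) : Pt d)) := by
  refine measurable_pi_iff.2 fun i => ?_
  refine Fin.cases ?_ (fun j => ?_) i
  · simpa using hf
  · simpa using measurable_pi_iff.1 hg j

lemma rep_measurable {α : ℝ} {F Ft : Pt d → Pt d → ℝ} (h1 : PsiRep α Ft F)
    (c1 : Continuous (fun p : Pt d × Pt d => Ft p.1 p.2)) :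
    Measurable (fun q : Pt d × Pt d => F q.1 q.2) := by
  have : (fun q : Pt d × Pt d => F q.1 q.2) = fun q => if q.2 0 < q.1 0 then
      (q.1 0 - q.2 0) ^ ((α - d - 2) / 2) *
        Ft q.2 (Fin.cons (Real.sqrt (q.1 0 - q.2 0))
          fun i : Fin d => (q.1 i.succ - q.2 i.succ) / Real.sqrt (q.1 0 - q.2 0))
    else 0 := by
    funext q
    exact h1 q.1 q.2
  rw [this]
  refine Measurable.ite (measurableSet_lt (by fun_prop) (by fun_prop)) ?_ measurable_const
  refine Measurable.mul (by fun_prop) ?_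
  refine c1.measurable.comp (Measurable.prodMk measurable_snd ?_)
  exact measurable_finCons (by fun_prop) (by fun_prop)

lemma rep_at {α : ℝ} {F Ft : Pt d → Pt d → ℝ} (h1 : PsiRep α Ft F) (z zb uv : Pt d)
    (hu : 0 < uv 0) (h0 : z 0 - zb 0 = uv 0 ^ 2)
    (hs : ∀ i : Fin d, z i.succ - zb i.succ = uv 0 * uv i.succ) :
    F z zb = (uv 0 ^ 2) ^ ((α - d - 2) / 2) * Ft zb uv := by
  have hlt : zb 0 < z 0 := by
    have : 0 < uv 0 ^ 2 := by positivity
    linarith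
  rw [h1 z zb, if_pos hlt, h0, Real.sqrt_sq hu.le]
  congr 2
  ext i
  refine Fin.cases ?_ (fun j => ?_) i
  · simp
  · simp only [Fin.cons_succ, hs]
    field_simp

lemma power_identity (d : ℕ) (α β a θ : ℝ) (ha : 0 < a) (hθ : θ ∈ Set.Ioo (0 : ℝ) 1) :
    jac d (√a) θ * ((a * (1 - θ)) ^ ((α - d - 2) / 2) * (a * θ) ^ ((β - d - 2) / 2)) =
      a ^ ((α + β - d - 2) / 2) * wt α β θ := by
  have h0 := hθ.1
  have h1 : 0 < 1 - θ := by linarith [hθ.2]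
  have hj : jac d (√a) θ = a * (a ^ ((d : ℝ) / 2) * (θ ^ ((d : ℝ) / 2) *
      (1 - θ) ^ ((d : ℝ) / 2))) := by
    have hsq : ∀ y : ℝ, 0 < y → √y ^ d = y ^ ((d : ℝ) / 2) := by
      intro y hy
      rw [Real.sqrt_eq_rpow, ← Real.rpow_natCast, ← Real.rpow_mul hy.le]
      congr 1
      ring
    rw [jac, Real.sq_sqrt ha.le, mul_pow, mul_pow, hsq _ ha, hsq _ h0, hsq _ h1]
  rw [hj, Real.mul_rpow ha.le h1.le, Real.mul_rpow ha.le h0.le, wt]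
  have ea : a ^ ((α + β - d - 2) / 2) = a * a ^ ((d : ℝ) / 2) * a ^ ((α - d - 2) / 2) *
      a ^ ((β - d - 2) / 2) := by
    nth_rewrite 2 [← Real.rpow_one a]
    rw [← Real.rpow_add ha, ← Real.rpow_add ha, ← Real.rpow_add ha]
    congr 1
    ring
  have e1 : (1 - θ) ^ (α / 2 - 1) = (1 - θ) ^ ((d : ℝ) / 2) * (1 - θ) ^ ((α - d - 2) / 2) := by
    rw [← Real.rpow_add h1]
    congr 1
    ring
  have e2 : θ ^ (β / 2 - 1) = θ ^ ((d : ℝ) / 2) * θ ^ ((β - d - 2) / 2) := by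
    rw [← Real.rpow_add h0]
    congr 1
    ring
  rw [ea, e1, e2]
  ring

lemma Ht_rep {α β : ℝ} {F Ft G Gt : Pt d → Pt d → ℝ} (h1 : PsiRep α Ft F) (h2 : PsiRep β Gt G)
    (c1 : Continuous (fun p : Pt d × Pt d => Ft p.1 p.2))
    (c2 : Continuous (fun p : Pt d × Pt d => Gt p.1 p.2)) :
    PsiRep (α + β) (Ht α β Ft Gt) (conv F G) := by
  intro z zb
  have hF0 : ∀ z zb : Pt d, ¬ zb 0 < z 0 → F z zb = 0 := fun z zb h => by rw [h1, if_neg h]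
  have hG0 : ∀ z zb : Pt d, ¬ zb 0 < z 0 → G z zb = 0 := fun z zb h => by rw [h2, if_neg h]
  by_cases hlt : zb 0 < z 0
  swap
  · rw [if_neg hlt, conv]
    have : ∀ ζ : Pt d, F z ζ * G ζ zb = 0 := by
      intro ζ
      by_cases h : ζ 0 < z 0
      · rw [hG0 ζ zb (fun h' => hlt (h'.trans h)), mul_zero]
      · rw [hF0 z ζ h, zero_mul]
    simp [this]
  rw [if_pos hlt, conv]
  set a := z 0 - zb 0 with ha
  have ha0 : 0 < a := sub_pos.2 hlt
  set u := √a with hu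
  have hu0 : 0 < u := Real.sqrt_pos.2 ha0
  have hu2 : u ^ 2 = a := Real.sq_sqrt ha0.le
  set v : Fin d → ℝ := fun i => (z i.succ - zb i.succ) / u with hv
  have hmeas : Measurable (fun y : ℝ × (Fin d → ℝ) =>
      F z (Fin.cons y.1 y.2) * G (Fin.cons y.1 y.2) zb) := by
    have hc : Measurable (fun y : ℝ × (Fin d → ℝ) => (Fin.cons y.1 y.2 : Pt d)) :=
      measurable_finCons measurable_fst measurable_snd
    exact ((rep_measurable h1 c1).comp (measurable_const.prodMk hc)).mul
      ((rep_measurable h2 c2).comp (hc.prodMk measurable_const))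
  have hres : (volume.restrict (Set.Ioo (zb 0) (zb 0 + u ^ 2))).prod
      (volume : Measure (Fin d → ℝ)) =
      (volume.prod volume).restrict (Set.Ioo (zb 0) (zb 0 + u ^ 2) ×ˢ Set.univ) := by
    rw [← Measure.prod_restrict, Measure.restrict_univ]
  rw [integral_pt, ← setIntegral_eq_integral_of_forall_compl_eq_zero
    (s := Set.Ioo (zb 0) (zb 0 + u ^ 2) ×ˢ Set.univ), ← hres,
    cov_integral (zb 0) u hu0 (Fin.tail zb) v _ hmeas, Ht, ← integral_const_mul]
  · refine integral_congr_ae ?_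
    filter_upwards [ae_mu0] with x hx
    obtain ⟨s0, s1, q0, q1, -, -⟩ := sqrt_facts hx
    have p := power_identity d α β a x.1 ha0 hx
    have ev : ∀ i, u * v i = z i.succ - zb i.succ := by
      intro i
      simp only [hv]
      field_simp
    have ecore : core Ft Gt zb (Fin.cons u v) x =
        Ft (Fin.cons (cov (zb 0) u (Fin.tail zb) v x).1 (cov (zb 0) u (Fin.tail zb) v x).2)
          (Fin.cons (u * √(1 - x.1)) (√(1 - x.1) • v + (-√x.1) • x.2)) *
        Gt zb (Fin.cons (u * √x.1) (√x.1 • v + √(1 - x.1) • x.2)) := by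
      simp only [core, Fin.cons_zero, Fin.tail_cons, abs_of_pos hu0]
    rw [ecore]
    have hFz := rep_at h1 z
      (Fin.cons (cov (zb 0) u (Fin.tail zb) v x).1 (cov (zb 0) u (Fin.tail zb) v x).2)
      (Fin.cons (u * √(1 - x.1)) (√(1 - x.1) • v + (-√x.1) • x.2))
      (by simp only [Fin.cons_zero]; positivity)
      (by
        simp only [Fin.cons_zero, cov]
        linear_combination (-1) * ha - hu2 - u ^ 2 * q1)
      (by
        intro i
        simp only [Fin.cons_zero, Fin.cons_succ, cov, Pi.add_apply, Pi.smul_apply, smul_eq_mul,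
          Fin.tail]
        linear_combination (-1) * ev i - u * v i * q1)
    have hGz := rep_at h2
      (Fin.cons (cov (zb 0) u (Fin.tail zb) v x).1 (cov (zb 0) u (Fin.tail zb) v x).2) zb
      (Fin.cons (u * √x.1) (√x.1 • v + √(1 - x.1) • x.2))
      (by simp only [Fin.cons_zero]; positivity)
      (by
        simp only [Fin.cons_zero, cov]
        linear_combination (-u ^ 2) * q0)
      (by
        intro i
        simp only [Fin.cons_zero, Fin.cons_succ, cov, Pi.add_apply, Pi.smul_apply, smul_eq_mul,
          Fin.tail]
        linear_combination (-u * v i) * q0)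
    have e1 : (u * √(1 - x.1)) ^ 2 = a * (1 - x.1) := by rw [mul_pow, hu2, sq, q1]
    have e2 : (u * √x.1) ^ 2 = a * x.1 := by rw [mul_pow, hu2, sq, q0]
    rw [Fin.cons_zero, e1] at hFz
    rw [Fin.cons_zero, e2] at hGz
    rw [← hu] at p
    rw [hFz, hGz, ← mul_assoc (a ^ ((α + β - d - 2) / 2)), ← p]
    ring
  · intro y hy
    have hy' : ¬ (zb 0 < y.1 ∧ y.1 < zb 0 + u ^ 2) := fun h => hy ⟨h, Set.mem_univ _⟩
    by_cases h : zb 0 < y.1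
    · have : ¬ y.1 < z 0 := fun h' => hy' ⟨h, by rw [hu2, ha]; linarith⟩
      rw [hF0 _ _ (by simpa using this), zero_mul]
    · rw [hG0 _ _ (by simpa using h), mul_zero]

lemma conv_mem {α β : ℝ} (hα : 0 < α) (hβ : 0 < β) {F G : Pt d → Pt d → ℝ} (hF : MemPsi α 0 F)
    (hG : MemPsi β 0 G) : MemPsi (α + β) 0 (conv F G) := by
  obtain ⟨Ft, f1, f2, f3⟩ := hF
  obtain ⟨Gt, g1, g2, g3⟩ := hG
  rw [psiSmooth_zero] at f2 g2
  simp only [bddAbove_iff] at f3 g3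
  refine ⟨Ht α β Ft Gt, Ht_rep f1 g1 f2 g2, (psiSmooth_zero _).2
    (Ht_continuous hα hβ f2 g2 f3 g3), fun T hT n => (bddAbove_iff _ _ _).2 ?_⟩
  obtain ⟨A, hA⟩ := f3 T hT (n + (d + 1))
  obtain ⟨B, hB⟩ := g3 T hT (n + (d + 1))
  exact Ht_bd hα hβ hA hB

lemma psiNorm_nonneg {α T : ℝ} {F : Pt d → Pt d → ℝ} (hF : MemPsi α 0 F) (hT : 0 < T) (n : ℕ) :
    0 ≤ psiNorm α 0 T n F := by
  obtain ⟨Ft, f1, f2, f3⟩ := hF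
  rw [psiNorm_eq f1 f2 (f3 T hT n)]
  exact (bd_sSup (f3 T hT n)).nonneg

lemma conv_norm {α β T : ℝ} (hα : (d : ℝ) < α) (hβ : 0 < β) {F G : Pt d → Pt d → ℝ}
    (hF : MemPsi α 0 F) (hG : MemPsi β 0 G) (hT : 0 < T) (n : ℕ) :
    psiNorm (α + β) 0 T n (conv F G) ≤
      (∫ q : Fin d → ℝ, prof q) * psiNorm α 0 T n F * psiNorm β 0 T (n + d + 1) G *
        betaFn ((α - d) / 2) (β / 2) := by
  have hα0 : 0 < α := lt_of_le_of_lt (Nat.cast_nonneg d) hα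
  obtain ⟨Ft, f1, f2, f3⟩ := hF
  obtain ⟨Gt, g1, g2, g3⟩ := hG
  rw [psiNorm_eq f1 f2 (f3 T hT n), psiNorm_eq g1 g2 (g3 T hT (n + d + 1))]
  have bF := bd_sSup (f3 T hT n)
  have bG := bd_sSup (g3 T hT (n + d + 1))
  rw [psiSmooth_zero] at f2 g2
  simp only [bddAbove_iff] at f3 g3
  have key := Ht_bd_sharp hα hβ f2 g2 f3 g3 hT bF bG
  rw [psiNorm_eq (Ht_rep f1 g1 f2 g2) ((psiSmooth_zero _).2
    (Ht_continuous hα0 hβ f2 g2 f3 g3)) ((bddAbove_iff _ _ _).2 ⟨_, key⟩)]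
  exact sSup_le_of_bd key

/-- Bounds on iterated convolutions.
Let `β > 0`, `r ∈ ℕ`, `T > 0` and `M ∈ ℕ` with `Mβ > d`.  There is a constant `C`
depending only on `d` and `r` such that for every `R ∈ Ψ_0^β` and every `j ∈ ℕ`,
`‖R^{*(M+j)}‖_{(M+j)β,0;T,r} ≤ C^j ‖R^{*M}‖_{Mβ,0;T,r} ‖R‖_{β,0;T,r+d+1}^j
  ∏_{i=1}^j B(((M+i−1)β−d)/2, β/2)`
(the product being `1` for `j = 0`); note that `R^{*M} ∈ Ψ_0^{Mβ}` by stability of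
these spaces under convolution. -/
theorem psi_selfconv_iterates (d : ℕ) (hd : 1 ≤ d) (r : ℕ) :
    ∃ C : ℝ, 0 < C ∧
      ∀ (β T : ℝ) (M : ℕ), 0 < β → 0 < T → (d : ℝ) < M * β →
        ∀ R : Pt d → Pt d → ℝ, MemPsi β 0 R →
          (∀ m : ℕ, MemPsi (((m + 1 : ℕ) : ℝ) * β) 0 (selfConv R m)) ∧
          ∀ j : ℕ,
            psiNorm (((M + j : ℕ) : ℝ) * β) 0 T r (selfConv R (M - 1 + j)) ≤
              C ^ j * psiNorm ((M : ℝ) * β) 0 T r (selfConv R (M - 1)) *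
                psiNorm β 0 T (r + d + 1) R ^ j *
                ∏ i ∈ Finset.range j, betaFn ((((M + i : ℕ) : ℝ) * β - d) / 2) (β / 2) := by
  have hI : 0 ≤ ∫ q : Fin d → ℝ, prof q := integral_nonneg prof_nonneg
  refine ⟨(∫ q : Fin d → ℝ, prof q) + 1, by linarith, ?_⟩
  intro β T M hβ hT hM R hR
  have hmem : ∀ m : ℕ, MemPsi (((m + 1 : ℕ) : ℝ) * β) 0 (selfConv R m) := by
    intro m
    induction m with
    | zero => simpa [selfConv] using hR
    | succ k ih =>
      have hk : 0 < ((k + 1 : ℕ) : ℝ) * β := by positivity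
      have := conv_mem hk hβ ih hR
      have e : ((k + 1 + 1 : ℕ) : ℝ) * β = ((k + 1 : ℕ) : ℝ) * β + β := by push_cast; ring
      rw [e]
      exact this
  refine ⟨hmem, fun j => ?_⟩
  have hM1 : 1 ≤ M := by
    rcases Nat.eq_zero_or_pos M with h | h
    · subst h
      have : (0 : ℝ) ≤ d := Nat.cast_nonneg d
      simp only [Nat.cast_zero, zero_mul] at hM
      linarith
    · exact h
  induction j with
  | zero => simp
  | succ j ih =>
    have hMj : ((M - 1 + j + 1 : ℕ) : ℝ) = ((M + j : ℕ) : ℝ) := by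
      congr 1
      omega
    have hd' : (d : ℝ) < ((M + j : ℕ) : ℝ) * β := by
      refine hM.trans_le ?_
      push_cast
      have : (0 : ℝ) ≤ j := Nat.cast_nonneg j
      nlinarith
    have hF := hmem (M - 1 + j)
    rw [hMj] at hF
    have step := conv_norm hd' hβ hF hR hT r
    have e : ((M + (j + 1) : ℕ) : ℝ) * β = ((M + j : ℕ) : ℝ) * β + β := by push_cast; ring
    have hB := betaFn_nonneg ((((M + j : ℕ) : ℝ) * β - d) / 2) (β / 2)
    have hn := psiNorm_nonneg hR hT (r + d + 1)
    have hn' := psiNorm_nonneg hF hT r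
    rw [e, Finset.prod_range_succ]
    set I := ∫ q : Fin d → ℝ, prof q with hIdef
    set N := psiNorm β 0 T (r + d + 1) R with hN
    set P := psiNorm (((M + j : ℕ) : ℝ) * β) 0 T r (selfConv R (M - 1 + j)) with hP
    set b := betaFn ((((M + j : ℕ) : ℝ) * β - d) / 2) (β / 2) with hb
    calc _ ≤ I * P * N * b := step
      _ ≤ (I + 1) * P * N * b := by gcongr; linarith
      _ ≤ (I + 1) * ((I + 1) ^ j * psiNorm ((M : ℝ) * β) 0 T r (selfConv R (M - 1)) * N ^ j *
          ∏ i ∈ Finset.range j, betaFn ((((M + i : ℕ) : ℝ) * β - d) / 2) (β / 2)) * N * b := by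
        gcongr
      _ = _ := by rw [pow_succ, pow_succ]; ring

end VarBPHZ
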